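/- Let η be a gauge invariant tensor with n+1 indices obtained as (dη')_{1⋯(n+1)} = d_{1} η'_{2⋯(n+1)} − η'_{1⋯n} d_{n+1} for a gauge invariant tensor η' with n indices and an arbitrary one-index tensor d. Then dη' is gauge invariant, and the operator Δ̄ of the previous statement commutes with this operation: Δ̄(dη') = d(Δ̄η'). -/

import Mathlib

open Matrix

/-- A tensor with `p` indices (a function on lists of indices, relevant on lists of
length `p`) is gauge invariant if the sum of the `p` tensors obtained by inserting the
first index into each of the `p` possible positions vanishes. -/
def GIT {D : ℕ} (p : ℕ) (η : List (Fin D) → ℂ) : Prop :=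
  ∀ (x : Fin D) (l : List (Fin D)), l.length = p - 1 →
    ∑ k ∈ Finset.range p, η (l.insertIdx k x) = 0

/-- The operator `Δ̄`: contraction of the antisymmetric matrix `Δ^{ab}` against the sum
of `η` over all insertions of the index pair `(a, b)` (with `a` preceding `b`) into the
index string, with overall factor `-i/2`. -/
noncomputable def DeltaBar {D : ℕ} (Δm : Matrix (Fin D) (Fin D) ℂ)
    (η : List (Fin D) → ℂ) : List (Fin D) → ℂ :=
  fun l => (-Complex.I / 2) * ∑ a : Fin D, ∑ b : Fin D, Δm a b *
    ∑ q ∈ Finset.range (l.length + 1), ∑ r ∈ Finset.range (q + 1),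
      η ((l.insertIdx q b).insertIdx r a)

/-- The covariant-derivative-like operation
`(dη')_{a₀a₁⋯aₙ} = d_{a₀} η'_{a₁⋯aₙ} - η'_{a₀⋯a_{n-1}} d_{aₙ}`. -/
def dTen {D : ℕ} (hD : 0 < D) (d : Fin D → ℂ) (η : List (Fin D) → ℂ) :
    List (Fin D) → ℂ :=
  fun l => d (l.headD ⟨0, hD⟩) * η l.tail - η l.dropLast * d (l.getLastD ⟨0, hD⟩)

theorem insertIdx_snoc {α : Type*} (x z : α) (s : List α) (k : ℕ) (hk : k ≤ s.length) :
    (s ++ [z]).insertIdx k x = s.insertIdx k x ++ [z] := by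
  induction s generalizing k with
  | nil =>
    have : k = 0 := by simpa using hk
    subst this
    simp
  | cons y t ih =>
    cases k with
    | zero => simp
    | succ k =>
      have := ih k (by simpa using hk)
      simp [this]

theorem dTen_cons_snoc_left {D : ℕ} (hD : 0 < D) (d : Fin D → ℂ) (η : List (Fin D) → ℂ)
    (n : ℕ) (hη : GIT n η) (y : Fin D) (t : List (Fin D)) (ht : t.length + 1 = n - 1)
    (a b : Fin D) :
    ∑ q ∈ Finset.range ((y :: t).length + 1), ∑ r ∈ Finset.range (q + 1),
      d ((((y :: t).insertIdx q b).insertIdx r a).headD ⟨0, hD⟩) *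
        η (((y :: t).insertIdx q b).insertIdx r a).tail =
    d y * ∑ q ∈ Finset.range (t.length + 1), ∑ r ∈ Finset.range (q + 1),
      η ((t.insertIdx q b).insertIdx r a) := by
  have h := hη b (y :: t) (by simpa using ht)
  have hn : n = t.length + 1 + 1 := by omega
  have h2 : ∑ q ∈ Finset.range ((y :: t).length + 1), ∑ r ∈ Finset.range q,
      d ((((y :: t).insertIdx q b).insertIdx (r+1) a).headD ⟨0, hD⟩) *
        η (((y :: t).insertIdx q b).insertIdx (r+1) a).tail =
      d y * ∑ q ∈ Finset.range (t.length + 1), ∑ r ∈ Finset.range (q + 1),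
        η ((t.insertIdx q b).insertIdx r a) := by
    rw [Finset.sum_range_succ']
    simp [Finset.mul_sum]
  have h3 : ∑ q ∈ Finset.range ((y :: t).length + 1),
      d ((((y :: t).insertIdx q b).insertIdx 0 a).headD ⟨0, hD⟩) *
        η (((y :: t).insertIdx q b).insertIdx 0 a).tail = 0 := by
    subst hn
    simp only [List.insertIdx_zero, List.headD_cons, List.tail_cons, List.length_cons]
    rw [← Finset.mul_sum, h, mul_zero]
  rw [← h2, ← add_zero (∑ q ∈ Finset.range ((y :: t).length + 1), ∑ r ∈ Finset.range q, _), ← h3,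
    ← Finset.sum_add_distrib]
  exact Finset.sum_congr rfl fun q _ => Finset.sum_range_succ' _ _

theorem dTen_cons_snoc_right {D : ℕ} (hD : 0 < D) (d : Fin D → ℂ) (η : List (Fin D) → ℂ)
    (n : ℕ) (hη : GIT n η) (z : Fin D) (s : List (Fin D)) (hs : s.length + 1 = n - 1)
    (a b : Fin D) :
    ∑ q ∈ Finset.range ((s ++ [z]).length + 1), ∑ r ∈ Finset.range (q + 1),
      η (((s ++ [z]).insertIdx q b).insertIdx r a).dropLast *
        d ((((s ++ [z]).insertIdx q b).insertIdx r a).getLastD ⟨0, hD⟩) =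
    (∑ q ∈ Finset.range (s.length + 1), ∑ r ∈ Finset.range (q + 1),
      η ((s.insertIdx q b).insertIdx r a)) * d z := by
  have h := hη a (s ++ [z]) (by simpa using hs)
  have hn : n = (s ++ [z]).length + 1 := by simp; omega
  rw [Finset.sum_range_succ]
  have h3 : ∑ r ∈ Finset.range ((s ++ [z]).length + 1),
      η (((s ++ [z]).insertIdx (s ++ [z]).length b).insertIdx r a).dropLast *
        d ((((s ++ [z]).insertIdx (s ++ [z]).length b).insertIdx r a).getLastD ⟨0, hD⟩) = 0 := by
    rw [hn] at h
    rw [← zero_mul (d b), ← h, Finset.sum_mul]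
    refine Finset.sum_congr rfl fun r hr => ?_
    rw [List.insertIdx_length_self, insertIdx_snoc _ _ _ _ (by simpa [Nat.lt_succ_iff] using hr)]
    simp
  rw [h3, add_zero, Finset.sum_mul, List.length_append, List.length_singleton]
  refine Finset.sum_congr rfl fun q hq => ?_
  have hq' : q ≤ s.length := by simpa [Nat.lt_succ_iff] using hq
  rw [Finset.sum_mul]
  refine Finset.sum_congr rfl fun r hr => ?_
  have hr' : r ≤ q := by simpa [Nat.lt_succ_iff] using hr
  rw [insertIdx_snoc _ _ _ _ hq', insertIdx_snoc _ _ _ _ (by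
    rw [List.length_insertIdx_of_le_length hq']; omega)]
  simp

/-- If `η'` is gauge invariant with `n` indices and `d` is any one-index tensor, then
`dη'` is gauge invariant (with `n + 1` indices) and `Δ̄(dη') = d(Δ̄η')`. -/
theorem stmt13 {D n : ℕ} (hD : 0 < D) (hn : 2 ≤ n)
    (η : List (Fin D) → ℂ) (d : Fin D → ℂ)
    (Δm : Matrix (Fin D) (Fin D) ℂ) (hΔ : Δmᵀ = -Δm) (hη : GIT n η) :
    GIT (n + 1) (dTen hD d η) ∧
    ∀ l : List (Fin D), l.length = n - 1 →
      DeltaBar Δm (dTen hD d η) l = dTen hD d (DeltaBar Δm η) l := by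
  constructor
  · intro x l hl
    simp only [Nat.add_sub_cancel] at hl
    simp only [dTen, Finset.sum_sub_distrib]
    have hA : ∑ k ∈ Finset.range (n + 1), d ((l.insertIdx k x).headD ⟨0, hD⟩) *
        η (l.insertIdx k x).tail = d x * η l := by
      rw [Finset.sum_range_succ']
      cases l with
      | nil => simp at hl; omega
      | cons y t =>
        have h := hη x t (by simp at hl; omega)
        simp only [List.insertIdx_succ_cons, List.insertIdx_zero, List.headD_cons, List.tail_cons]
        rw [← Finset.mul_sum, h]
        simp
    have hB : ∑ k ∈ Finset.range (n + 1), η (l.insertIdx k x).dropLast *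
        d ((l.insertIdx k x).getLastD ⟨0, hD⟩) = η l * d x := by
      rw [Finset.sum_range_succ]
      rcases List.eq_nil_or_concat l with rfl | ⟨s, z, rfl⟩
      · simp at hl; omega
      · have hs : s.length + 1 = n := by simpa using hl
        have h := hη x s (by omega)
        have h1 : ∑ k ∈ Finset.range n, η ((s ++ [z]).insertIdx k x).dropLast *
            d (((s ++ [z]).insertIdx k x).getLastD ⟨0, hD⟩) = 0 := by
          rw [← zero_mul (d z), ← h, Finset.sum_mul]
          refine Finset.sum_congr rfl fun k hk => ?_
          rw [Finset.mem_range] at hk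
          rw [insertIdx_snoc _ _ _ _ (by omega)]
          simp
        rw [List.concat_eq_append] at *
        rw [h1, ← hl, List.insertIdx_length_self]
        simp
    rw [hA, hB]
    ring
  · intro l hl
    have hA : ∀ a b : Fin D, ∑ q ∈ Finset.range (l.length + 1), ∑ r ∈ Finset.range (q + 1),
        d (((l.insertIdx q b).insertIdx r a).headD ⟨0, hD⟩) *
          η ((l.insertIdx q b).insertIdx r a).tail =
        d (l.headD ⟨0, hD⟩) * ∑ q ∈ Finset.range (l.tail.length + 1),
          ∑ r ∈ Finset.range (q + 1), η ((l.tail.insertIdx q b).insertIdx r a) := by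
      intro a b
      cases l with
      | nil => simp at hl; omega
      | cons y t => exact dTen_cons_snoc_left hD d η n hη y t (by simpa using hl) a b
    have hB : ∀ a b : Fin D, ∑ q ∈ Finset.range (l.length + 1), ∑ r ∈ Finset.range (q + 1),
        η ((l.insertIdx q b).insertIdx r a).dropLast *
          d (((l.insertIdx q b).insertIdx r a).getLastD ⟨0, hD⟩) =
        (∑ q ∈ Finset.range (l.dropLast.length + 1),
          ∑ r ∈ Finset.range (q + 1), η ((l.dropLast.insertIdx q b).insertIdx r a)) *
          d (l.getLastD ⟨0, hD⟩) := by
      intro a b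
      rcases List.eq_nil_or_concat l with rfl | ⟨s, z, rfl⟩
      · simp at hl; omega
      · have := dTen_cons_snoc_right hD d η n hη z s (by simpa using hl) a b
        simpa using this
    simp only [DeltaBar, dTen, Finset.sum_sub_distrib, hA, hB, mul_sub]
    congr 1
    · rw [mul_left_comm]
      congr 1
      rw [Finset.mul_sum]
      refine Finset.sum_congr rfl fun a _ => ?_
      rw [Finset.mul_sum]
      refine Finset.sum_congr rfl fun b _ => ?_
      ring
    · rw [mul_assoc, Finset.sum_mul]
      congr 1
      refine Finset.sum_congr rfl fun a _ => ?_
      rw [Finset.sum_mul]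
      refine Finset.sum_congr rfl fun b _ => ?_
      ring
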